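/- Fix M > 1. There is a constant C = C(M) > 0 such that for every analytic function f from the unit disc 𝔻 into its closure with f(0) = 0 and ‖f‖_∞ ≤ 1, and every η > 0, the set of points ξ on the unit circle whose Stolz angle Γ_M(ξ) = {z ∈ 𝔻 : |z − ξ| < M(1 − |z|)} intersects {z ∈ 𝔻 : |f(z) − 1| < η} has normalized Lebesgue measure at most C·η. -/

import Mathlib

open Complex MeasureTheory

/-- A covering estimate: if every point of `E` is the centre of a closed ball whose `ν`-measure is
at least `a` times its radius, then `volume E ≤ (8 / a) * ν univ`. -/
lemma volume_le_of_forall_exists_le_measure_closedBall (ν : Measure ℝ) [IsFiniteMeasure ν]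
    (E : Set ℝ) {a : ℝ} (ha : 0 < a)
    (h : ∀ x ∈ E, ∃ ρ > (0 : ℝ), ENNReal.ofReal (a * ρ) ≤ ν (Metric.closedBall x ρ)) :
    volume E ≤ ENNReal.ofReal (8 / a) * ν Set.univ := by
  choose! ρ hρ0 hρ using h
  have hbound : ∀ x ∈ E, ρ x ≤ (ν Set.univ).toReal / a := by
    intro x hx
    rw [le_div_iff₀' ha]
    exact (ENNReal.ofReal_le_iff_le_toReal (measure_ne_top ν _)).1
      ((hρ x hx).trans (measure_mono (Set.subset_univ _)))
  obtain ⟨u, huE, hdisj, hcov⟩ :=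
    Vitali.exists_disjoint_subfamily_covering_enlargement_closedBall E (fun x => x) ρ _ hbound 4
      (by norm_num)
  have hu : u.Countable := hdisj.countable_of_nonempty_interior fun x hx =>
    ⟨x, Metric.ball_subset_interior_closedBall (Metric.mem_ball_self (hρ0 x (huE hx)))⟩
  have hsub : E ⊆ ⋃ x ∈ u, Metric.closedBall x (4 * ρ x) := by
    intro x hx
    obtain ⟨b, hb, hxb⟩ := hcov x hx
    exact Set.mem_biUnion hb (hxb (Metric.mem_closedBall_self (hρ0 x hx).le))
  have := hu.to_subtype
  calc volume E ≤ volume (⋃ x ∈ u, Metric.closedBall x (4 * ρ x)) := measure_mono hsub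
    _ ≤ ∑' x : u, volume (Metric.closedBall (x : ℝ) (4 * ρ x)) := measure_biUnion_le _ hu _
    _ ≤ ∑' x : u, ENNReal.ofReal (8 / a) * ν (Metric.closedBall (x : ℝ) (ρ x)) := by
        refine ENNReal.tsum_le_tsum fun x => ?_
        refine le_trans ?_ (mul_le_mul_right (hρ x (huE x.2)) _)
        rw [Real.volume_closedBall, ← ENNReal.ofReal_mul (by positivity)]
        refine ENNReal.ofReal_le_ofReal (le_of_eq ?_)
        field_simp
        ring
    _ = ENNReal.ofReal (8 / a) * ν (⋃ x ∈ u, Metric.closedBall x (ρ x)) := by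
        rw [ENNReal.tsum_mul_left,
          measure_biUnion hu hdisj fun x _ => Metric.isClosed_closedBall.measurableSet]
    _ ≤ ENNReal.ofReal (8 / a) * ν Set.univ := by gcongr; exact Set.subset_univ _

/-- Integration of a Poisson-like bump at scale `δ` against a measure with linear growth. -/
lemma lintegral_div_max_sq_le (ν : Measure ℝ) {a δ θ : ℝ} (ha : 0 < a) (hδ : 0 < δ)
    (h : ∀ ρ > (0 : ℝ), ν (Metric.closedBall θ ρ) ≤ ENNReal.ofReal (a * ρ)) :
    ∫⁻ t, ENNReal.ofReal (δ / max δ |t - θ| ^ 2) ∂ν ≤ ENNReal.ofReal (8 * a) := by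
  set c : ℕ → ENNReal := fun n => ENNReal.ofReal (4 * (1 / 4) ^ n / δ) with hc
  set B : ℕ → Set ℝ := fun n => Metric.closedBall θ (2 ^ n * δ) with hB
  have hpt : ∀ t, ENNReal.ofReal (δ / max δ |t - θ| ^ 2)
      ≤ ∑' n, (B n).indicator (fun _ => c n) t := by
    intro t
    suffices ∃ n, t ∈ B n ∧ δ / max δ |t - θ| ^ 2 ≤ 4 * (1 / 4) ^ n / δ by
      obtain ⟨n, hn, hle⟩ := this
      refine le_trans ?_ (ENNReal.le_tsum n)
      rw [Set.indicator_of_mem hn]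
      exact ENNReal.ofReal_le_ofReal hle
    rcases le_or_gt |t - θ| δ with ht | ht
    · refine ⟨0, by simpa [hB, Real.dist_eq] using ht, ?_⟩
      rw [max_eq_left ht, div_le_div_iff₀ (by positivity) hδ]
      nlinarith [sq_nonneg δ]
    · obtain ⟨n, hn1, hn2⟩ := exists_nat_pow_near ((one_le_div hδ).2 ht.le) one_lt_two
      rw [le_div_iff₀ hδ] at hn1
      rw [div_lt_iff₀ hδ] at hn2
      refine ⟨n + 1, by simpa [hB, Real.dist_eq] using hn2.le, ?_⟩
      rw [max_eq_right ht.le]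
      have hsq : (2 ^ n * δ) ^ 2 ≤ |t - θ| ^ 2 := by gcongr
      calc δ / |t - θ| ^ 2 ≤ δ / (2 ^ n * δ) ^ 2 := by gcongr
        _ = 4 * (1 / 4) ^ (n + 1) / δ := by
          rw [mul_pow, ← pow_mul, mul_comm n 2, pow_mul, one_div_pow, pow_succ]
          norm_num
          field_simp
          ring
  have hBm : ∀ n, MeasurableSet (B n) := fun n => Metric.isClosed_closedBall.measurableSet
  calc ∫⁻ t, ENNReal.ofReal (δ / max δ |t - θ| ^ 2) ∂ν
      ≤ ∫⁻ t, ∑' n, (B n).indicator (fun _ => c n) t ∂ν := lintegral_mono hpt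
    _ = ∑' n, c n * ν (B n) := by
        rw [lintegral_tsum fun n => (measurable_const.indicator (hBm n)).aemeasurable]
        simp_rw [lintegral_indicator_const (hBm _)]
    _ ≤ ∑' n : ℕ, ENNReal.ofReal (4 * a * (1 / 2) ^ n) := by
        refine ENNReal.tsum_le_tsum fun n => ?_
        refine (mul_le_mul_right (h _ (by positivity)) _).trans ?_
        rw [← ENNReal.ofReal_mul (by positivity)]
        refine ENNReal.ofReal_le_ofReal (le_of_eq ?_)
        have : (1 / 4 : ℝ) ^ n * 2 ^ n = (1 / 2) ^ n := by rw [← mul_pow]; norm_num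
        rw [← this]
        field_simp
    _ = ENNReal.ofReal (8 * a) := by
        rw [← ENNReal.ofReal_tsum_of_nonneg (fun n => by positivity)
          (summable_geometric_two.mul_left _), tsum_mul_left, tsum_geometric_two]
        ring_nf

lemma two_div_pi_mul_abs_le_norm_exp_sub_exp {s t : ℝ} (h : |t - s| ≤ Real.pi) :
    2 / Real.pi * |t - s| ≤ ‖exp (t * I) - exp (s * I)‖ := by
  have h1 : exp (t * I) - exp (s * I) = exp (s * I) * (exp (I * ((t - s : ℝ) : ℂ)) - 1) := by
    rw [mul_sub, ← exp_add]
    push_cast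
    ring_nf
  rw [h1, norm_mul, norm_exp_ofReal_mul_I, one_mul, norm_exp_I_mul_ofReal_sub_one, norm_mul,
    Real.norm_eq_abs, Real.norm_eq_abs]
  have h2 : |(t - s) / 2| = |t - s| / 2 := by rw [abs_div]; norm_num
  have h3 := Real.mul_abs_le_abs_sin (x := (t - s) / 2) (by rw [h2]; linarith)
  rw [h2] at h3
  norm_num
  linarith

/-- Comparison of the Poisson kernel at a point of a Stolz angle with a bump at its vertex. -/
lemma poissonKernel_le_of_mem_stolz {M r t θ : ℝ} {z : ℂ} (hM : 0 ≤ M) (hr : 1 / 2 ≤ r)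
    (hr1 : r ≤ 1) (hz : ‖z‖ < r) (hS : ‖z - r * exp (θ * I)‖ < M * (r - ‖z‖))
    (ht : |t - θ| ≤ Real.pi) :
    poissonKernel 0 z (circleMap 0 r t)
      ≤ 32 * (1 + M) ^ 2 * ((r - ‖z‖) / max (r - ‖z‖) |t - θ| ^ 2) := by
  have hδ : 0 < r - ‖z‖ := sub_pos.2 hz
  set d := ‖circleMap 0 r t - z‖ with hd
  have hnorm : ‖circleMap 0 r t‖ = r := by
    rw [norm_circleMap_zero, abs_of_nonneg (by linarith)]
  have hd1 : r - ‖z‖ ≤ d := by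
    have := norm_sub_norm_le (circleMap 0 r t) z
    rwa [hnorm] at this
  have hd0 : 0 < d := hδ.trans_le hd1
  have hd2 : |t - θ| ≤ 4 * (1 + M) * d := by
    have h1 : r * ‖exp (t * I) - exp (θ * I)‖ ≤ (1 + M) * d := by
      calc r * ‖exp (t * I) - exp (θ * I)‖
          = ‖(circleMap 0 r t - z) + (z - r * exp (θ * I))‖ := by
            rw [sub_add_sub_cancel, circleMap_zero, ← mul_sub, norm_mul, norm_real,
              Real.norm_of_nonneg (by linarith)]
        _ ≤ d + M * (r - ‖z‖) := (norm_add_le _ _).trans (by gcongr)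
        _ ≤ d + M * d := by gcongr
        _ = (1 + M) * d := by ring
    have h2 := two_div_pi_mul_abs_le_norm_exp_sub_exp ht
    have h3 : 1 / 2 * |t - θ| ≤ 2 / Real.pi * |t - θ| := by
      refine mul_le_mul_of_nonneg_right ?_ (abs_nonneg _)
      rw [div_le_div_iff₀ (by norm_num) Real.pi_pos]
      linarith [Real.pi_le_four]
    have h4 : 1 / 2 * ‖exp (t * I) - exp (θ * I)‖ ≤ r * ‖exp (t * I) - exp (θ * I)‖ := by gcongr
    linarith
  have hmax : max (r - ‖z‖) |t - θ| ≤ 4 * (1 + M) * d :=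
    max_le (hd1.trans (by nlinarith)) hd2
  have hmax0 : 0 < max (r - ‖z‖) |t - θ| := lt_max_of_lt_left hδ
  rw [poissonKernel_def, sub_zero, sub_zero, hnorm, ← hd, ← mul_div_assoc,
    div_le_div_iff₀ (by positivity) (by positivity)]
  have h5 : max (r - ‖z‖) |t - θ| ^ 2 ≤ (4 * (1 + M) * d) ^ 2 := by gcongr
  have h6 : r ^ 2 - ‖z‖ ^ 2 ≤ 2 * (r - ‖z‖) := by nlinarith [norm_nonneg z]
  calc (r ^ 2 - ‖z‖ ^ 2) * max (r - ‖z‖) |t - θ| ^ 2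
      ≤ (2 * (r - ‖z‖)) * (4 * (1 + M) * d) ^ 2 := by gcongr
    _ = 32 * (1 + M) ^ 2 * (r - ‖z‖) * d ^ 2 := by ring

/-- The real form of the Poisson integral formula, over an arbitrary period. -/
lemma re_eq_integral_poissonKernel {G : ℂ → ℂ} {r : ℝ} {z : ℂ}
    (hG : DiffContOnCl ℂ G (Metric.ball 0 r)) (hz : ‖z‖ < r) (s : ℝ) :
    (G z).re = (2 * Real.pi)⁻¹ * ∫ t in s..s + 2 * Real.pi,
      poissonKernel 0 z (circleMap 0 r t) * (G (circleMap 0 r t)).re := by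
  have hr : 0 < r := (norm_nonneg z).trans_lt hz
  have hP := hG.circleAverage_poissonKernel_smul (mem_ball_zero_iff.2 hz)
  set φ : ℝ → ℂ := fun t => poissonKernel 0 z (circleMap 0 r t) • G (circleMap 0 r t) with hφ
  have hper : Function.Periodic φ (2 * Real.pi) := fun t => by
    simp only [hφ, periodic_circleMap 0 r t]
  have hmem : ∀ t, circleMap 0 r t ∈ closure (Metric.ball (0 : ℂ) r) := fun t => by
    rw [closure_ball _ hr.ne']
    exact circleMap_mem_closedBall 0 hr.le t
  have hGc : Continuous fun t => G (circleMap 0 r t) :=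
    hG.2.comp_continuous (continuous_circleMap 0 r) hmem
  have hPc : Continuous fun t => poissonKernel 0 z (circleMap 0 r t) := by
    simp only [poissonKernel_def, sub_zero]
    refine Continuous.div (by fun_prop) (by fun_prop) fun t => ?_
    have : circleMap 0 r t - z ≠ 0 := fun h => by
      rw [sub_eq_zero] at h
      rw [← h, norm_circleMap_zero, abs_of_pos hr] at hz
      exact lt_irrefl _ hz
    positivity
  have hφc : Continuous φ := hPc.smul hGc
  have hint : ∫ t in 0..2 * Real.pi, φ t = ∫ t in s..s + 2 * Real.pi, φ t := by
    simpa using hper.intervalIntegral_add_eq 0 s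
  rw [Real.circleAverage_def] at hP
  have hPs : (2 * Real.pi)⁻¹ • ∫ t in s..s + 2 * Real.pi, φ t = G z := by
    rw [← hint]; exact hP
  rw [← hPs, Complex.smul_re, smul_eq_mul]
  congr 1
  have := reCLM.intervalIntegral_comp_comm
    (hφc.intervalIntegrable (μ := volume) s (s + 2 * Real.pi))
  simp only [reCLM_apply] at this
  rw [← this]
  exact intervalIntegral.integral_congr fun t _ => by simp [hφ]

/-- Weak type estimate for the nontangential maximal function of the positive harmonic function
`Re G`, on a circle of radius `r < 1`. -/
lemma volume_stolz_re_gt_le {M : ℝ} (hM : 0 ≤ M) {G : ℂ → ℂ}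
    (hG : DifferentiableOn ℂ G (Metric.ball 0 1)) (hpos : ∀ z ∈ Metric.ball (0 : ℂ) 1, 0 ≤ (G z).re)
    {r : ℝ} (hr : 1 / 2 ≤ r) (hr1 : r < 1) {lam : ℝ} (hlam : 0 < lam) :
    volume {θ : ℝ | θ ∈ Set.Ico 0 (2 * Real.pi) ∧
        ∃ z : ℂ, ‖z - r * exp (θ * I)‖ < M * (r - ‖z‖) ∧ lam < (G z).re ∧ ‖z‖ < r}
      ≤ ENNReal.ofReal (64 * Real.pi * (32 * (1 + M) ^ 2) * (G 0).re / lam) := by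
  have hr0 : 0 < r := by linarith
  set A : ℝ := 32 * (1 + M) ^ 2 with hA
  have hA0 : 0 < A := by positivity
  have hGr : DiffContOnCl ℂ G (Metric.ball 0 r) := by
    refine DifferentiableOn.diffContOnCl (hG.mono ?_)
    rw [closure_ball _ hr0.ne']
    exact Metric.closedBall_subset_ball hr1
  have hmem : ∀ t, circleMap 0 r t ∈ Metric.ball (0 : ℂ) 1 := fun t =>
    Metric.closedBall_subset_ball hr1 (circleMap_mem_closedBall 0 hr0.le t)
  set w : ℝ → ℝ := fun t => (G (circleMap 0 r t)).re with hw
  have hwc : Continuous w :=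
    continuous_re.comp (hG.continuousOn.comp_continuous (continuous_circleMap 0 r) hmem)
  have hw0 : ∀ t, 0 ≤ w t := fun t => hpos _ (hmem t)
  set J := Set.Ioc (-Real.pi) (-Real.pi + 2 * Real.pi + 2 * Real.pi) with hJ
  set W : ℝ → ENNReal := fun t => ENNReal.ofReal (w t) with hW
  have hWm : Measurable W := hwc.measurable.ennreal_ofReal
  set ν := (volume.restrict J).withDensity W with hν
  have hmean : ∀ s, ∫ t in s..s + 2 * Real.pi, w t = 2 * Real.pi * (G 0).re := by
    intro s
    have h1 := re_eq_integral_poissonKernel hGr (z := 0) (by simpa using hr0) s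
    rw [h1, mul_inv_cancel_left₀ (by positivity)]
    refine intervalIntegral.integral_congr fun t _ => ?_
    simp [poissonKernel_def, hr0.ne', hw]
  have hνuniv : ν Set.univ = ENNReal.ofReal (4 * Real.pi * (G 0).re) := by
    rw [hν, withDensity_apply _ MeasurableSet.univ, Measure.restrict_univ,
      ← ofReal_integral_eq_lintegral_ofReal (hwc.integrableOn_Ioc)
        (Filter.Eventually.of_forall hw0),
      ← intervalIntegral.integral_of_le (by linarith [Real.pi_pos]),
      ← intervalIntegral.integral_add_adjacent_intervals
        (hwc.intervalIntegrable _ (-Real.pi + 2 * Real.pi)) (hwc.intervalIntegrable _ _),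
      hmean, hmean]
    ring_nf
  have : IsFiniteMeasure ν := ⟨by rw [hνuniv]; exact ENNReal.ofReal_lt_top⟩
  set a := lam / (2 * A) with ha
  have ha0 : 0 < a := by positivity
  refine (volume_le_of_forall_exists_le_measure_closedBall ν _ ha0 ?_).trans ?_
  · rintro θ ⟨hθ, z, hS, hz, hzr⟩
    by_contra! hcon
    have hK := lintegral_div_max_sq_le ν ha0 (sub_pos.2 hzr) fun ρ hρ => (hcon ρ hρ).le
    set K : ℝ → ℝ := fun t => (r - ‖z‖) / max (r - ‖z‖) |t - θ| ^ 2 with hKdef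
    have hδ : 0 < r - ‖z‖ := sub_pos.2 hzr
    have hmax : ∀ t, 0 < max (r - ‖z‖) |t - θ| := fun t => lt_max_of_lt_left hδ
    have hKc : Continuous K := by
      refine Continuous.div (by fun_prop) (by fun_prop) fun t => (pow_pos (hmax t) 2).ne'
    have hK0 : ∀ t, 0 ≤ K t := fun t => div_nonneg hδ.le (sq_nonneg _)
    have hI := re_eq_integral_poissonKernel hGr hzr (θ - Real.pi)
    have hle : θ - Real.pi ≤ θ - Real.pi + 2 * Real.pi := by linarith [Real.pi_pos]
    have hlow : 2 * Real.pi * lam < ∫ t in Set.Ioc (θ - Real.pi) (θ - Real.pi + 2 * Real.pi),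
        poissonKernel 0 z (circleMap 0 r t) * w t := by
      rw [← intervalIntegral.integral_of_le hle]
      rw [hI, inv_mul_eq_div, lt_div_iff₀ (by positivity)] at hz
      linarith
    have hup : ∫ t in Set.Ioc (θ - Real.pi) (θ - Real.pi + 2 * Real.pi),
        poissonKernel 0 z (circleMap 0 r t) * w t
        ≤ ∫ t in Set.Ioc (θ - Real.pi) (θ - Real.pi + 2 * Real.pi), A * (K t * w t) := by
      refine integral_mono_of_nonneg (Filter.Eventually.of_forall fun t => ?_)
        (Continuous.integrableOn_Ioc (by fun_prop)) ?_
      · refine mul_nonneg ?_ (hw0 t)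
        rw [poissonKernel_def, sub_zero, sub_zero, norm_circleMap_zero, sq_abs]
        have : ‖z‖ ^ 2 ≤ r ^ 2 := by gcongr
        exact div_nonneg (by linarith) (sq_nonneg _)
      · filter_upwards [ae_restrict_mem measurableSet_Ioc] with t ht
        have := poissonKernel_le_of_mem_stolz (t := t) hM hr hr1.le hzr hS
          (abs_le.2 ⟨by linarith [ht.1], by linarith [ht.2]⟩)
        calc _ ≤ A * K t * w t := mul_le_mul_of_nonneg_right this (hw0 t)
          _ = _ := by ring
    rw [integral_const_mul] at hup
    have hfin : ENNReal.ofReal (∫ t in Set.Ioc (θ - Real.pi) (θ - Real.pi + 2 * Real.pi), K t * w t)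
        ≤ ENNReal.ofReal (8 * a) := by
      rw [ofReal_integral_eq_lintegral_ofReal (Continuous.integrableOn_Ioc (by fun_prop))
        (Filter.Eventually.of_forall fun t => mul_nonneg (hK0 t) (hw0 t))]
      refine le_trans ?_ hK
      rw [hν, lintegral_withDensity_eq_lintegral_mul _ hWm hKc.measurable.ennreal_ofReal]
      refine (lintegral_mono fun t => le_of_eq ?_).trans (lintegral_mono_set (t := J) ?_)
      · rw [ENNReal.ofReal_mul (hK0 t), Pi.mul_apply, mul_comm]
      · exact Set.Ioc_subset_Ioc (by linarith [hθ.1]) (by linarith [hθ.2])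
    rw [ENNReal.ofReal_le_ofReal_iff (by positivity)] at hfin
    have h8 : A * (8 * a) = 4 * lam := by rw [ha]; field_simp; norm_num
    have := mul_le_mul_of_nonneg_left hfin hA0.le
    nlinarith [Real.pi_gt_three]
  · rw [hνuniv, ← ENNReal.ofReal_mul (by positivity)]
    refine ENNReal.ofReal_le_ofReal (le_of_eq ?_)
    rw [ha]
    field_simp
    ring

/-- Fix `M > 1`. There is `C = C(M) > 0` such that for every analytic
`f : 𝔻 → closure 𝔻` with `f 0 = 0` and every `η > 0`, the set of boundary points
`ξ = e^{iθ}` whose Stolz angle `Γ_M(ξ) = {z ∈ 𝔻 : |z - ξ| < M(1 - |z|)}` meets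
`{z ∈ 𝔻 : |f z - 1| < η}` has (normalized) Lebesgue measure at most `C·η`. -/
theorem stolz_projection_estimate (M : ℝ) (hM : 1 < M) :
    ∃ C > (0:ℝ), ∀ f : ℂ → ℂ, DifferentiableOn ℂ f (Metric.ball 0 1) →
      (∀ z ∈ Metric.ball (0:ℂ) 1, ‖f z‖ ≤ 1) → f 0 = 0 →
      ∀ η : ℝ, 0 < η →
      volume {θ : ℝ | θ ∈ Set.Ico 0 (2 * Real.pi) ∧
          ∃ z ∈ Metric.ball (0:ℂ) 1,
            ‖z - Complex.exp (θ * Complex.I)‖ < M * (1 - ‖z‖) ∧ ‖f z - 1‖ < η}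
        ≤ ENNReal.ofReal (C * η) := by
  refine ⟨128 * Real.pi * (32 * (1 + M) ^ 2), by positivity, ?_⟩
  intro f hf hf1 hf0 η hη
  set G : ℂ → ℂ := fun z => (1 + η - f z)⁻¹ with hG
  have hre : ∀ z ∈ Metric.ball (0 : ℂ) 1, η ≤ (1 + η - f z).re := fun z hz => by
    have := (re_le_norm (f z)).trans (hf1 z hz)
    simp only [sub_re, add_re, one_re, ofReal_re]
    linarith
  have hne : ∀ z ∈ Metric.ball (0 : ℂ) 1, 1 + η - f z ≠ 0 := fun z hz h => by
    have := hre z hz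
    rw [h, zero_re] at this
    linarith
  have hGd : DifferentiableOn ℂ G (Metric.ball 0 1) :=
    DifferentiableOn.inv (by fun_prop) hne
  have hGpos : ∀ z ∈ Metric.ball (0 : ℂ) 1, 0 ≤ (G z).re := fun z hz => by
    rw [hG, inv_re]
    exact div_nonneg (hη.le.trans (hre z hz)) (normSq_nonneg _)
  have hGbig : ∀ z ∈ Metric.ball (0 : ℂ) 1, ‖f z - 1‖ < η → 1 / (2 * η) < (G z).re := by
    intro z hz hfz
    have h1 : normSq (f z - 1) < η ^ 2 := by
      rw [normSq_eq_norm_sq]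
      gcongr
    rw [hG, inv_re, div_lt_div_iff₀ (by positivity) (normSq_pos.2 (hne z hz))]
    simp only [normSq_apply, sub_re, sub_im, add_re, add_im, one_re, one_im, ofReal_re,
      ofReal_im] at h1 ⊢
    nlinarith
  have hG0 : (G 0).re ≤ 1 := by
    have : G 0 = (((1 + η)⁻¹ : ℝ) : ℂ) := by simp [hG, hf0]
    rw [this, ofReal_re]
    exact inv_le_one_of_one_le₀ (by linarith)
  set S : ℝ → Set ℝ := fun r => {θ : ℝ | θ ∈ Set.Ico 0 (2 * Real.pi) ∧
    ∃ z : ℂ, ‖z - r * exp (θ * I)‖ < M * (r - ‖z‖) ∧ 1 / (2 * η) < (G z).re ∧ ‖z‖ < r} with hS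
  have hSmono : Monotone S := by
    rintro r s hrs θ ⟨hθ, z, h1, h2, h3⟩
    refine ⟨hθ, z, ?_, h2, h3.trans_le hrs⟩
    have h4 : ‖((r : ℂ) - s) * exp (θ * I)‖ = s - r := by
      rw [norm_mul, norm_exp_ofReal_mul_I, mul_one, ← ofReal_sub, norm_real, Real.norm_eq_abs,
        abs_sub_comm, abs_of_nonneg (sub_nonneg.2 hrs)]
    calc ‖z - s * exp (θ * I)‖ = ‖(z - r * exp (θ * I)) + ((r : ℂ) - s) * exp (θ * I)‖ := by
          ring_nf
      _ ≤ ‖z - r * exp (θ * I)‖ + (s - r) := (norm_add_le _ _).trans_eq (by rw [h4])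
      _ < M * (s - ‖z‖) := by nlinarith
  set ρ : ℕ → ℝ := fun n => 1 - 1 / (n + 2) with hρ
  have hρmono : Monotone ρ := fun m n hmn => by
    have : (m : ℝ) ≤ n := by exact_mod_cast hmn
    simp only [hρ]
    gcongr
  have hρlim : Filter.Tendsto ρ Filter.atTop (nhds 1) := by
    have h := (tendsto_one_div_add_atTop_nhds_zero_nat (𝕜 := ℝ)).comp
      (Filter.tendsto_add_atTop_nat 1)
    have hlim := h.const_sub 1
    rw [sub_zero] at hlim
    refine hlim.congr fun n => ?_
    simp only [hρ, Function.comp]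
    push_cast
    ring_nf
  have hsub : {θ : ℝ | θ ∈ Set.Ico 0 (2 * Real.pi) ∧
          ∃ z ∈ Metric.ball (0:ℂ) 1,
            ‖z - Complex.exp (θ * Complex.I)‖ < M * (1 - ‖z‖) ∧ ‖f z - 1‖ < η} ⊆
      ⋃ n, S (ρ n) := by
    rintro θ ⟨hθ, z, hz, h1, h2⟩
    have hc1 : Filter.Tendsto (fun n => ‖z - ρ n * exp (θ * I)‖) Filter.atTop
        (nhds ‖z - ((1 : ℝ) : ℂ) * exp (θ * I)‖) :=
      (((continuous_ofReal.tendsto 1).comp hρlim).mul_const _ |>.const_sub z).norm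
    rw [ofReal_one, one_mul] at hc1
    have hc2 := (hρlim.sub_const ‖z‖).const_mul M
    have hc3 := hρlim.eventually (lt_mem_nhds (mem_ball_zero_iff.1 hz))
    obtain ⟨n, hn1, hn2⟩ := ((hc1.eventually_lt hc2 h1).and hc3).exists
    exact Set.mem_iUnion.2 ⟨n, hθ, z, hn1, hGbig z hz h2, hn2⟩
  refine (measure_mono hsub).trans ?_
  rw [Monotone.measure_iUnion fun m n hmn => hSmono (hρmono hmn)]
  refine iSup_le fun n => ?_
  have hn : (0 : ℝ) ≤ n := n.cast_nonneg
  have hn1 : 1 / 2 ≤ ρ n := by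
    have : 1 / ((n : ℝ) + 2) ≤ 1 / 2 := by gcongr; linarith
    simp only [hρ]
    linarith
  have hn2 : ρ n < 1 := by
    have : 0 < 1 / ((n : ℝ) + 2) := by positivity
    simp only [hρ]
    linarith
  refine (volume_stolz_re_gt_le (by linarith) hGd hGpos hn1 hn2
    (lam := 1 / (2 * η)) (by positivity)).trans (ENNReal.ofReal_le_ofReal ?_)
  calc 64 * Real.pi * (32 * (1 + M) ^ 2) * (G 0).re / (1 / (2 * η))
      ≤ 64 * Real.pi * (32 * (1 + M) ^ 2) * 1 / (1 / (2 * η)) := by gcongr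
    _ = 128 * Real.pi * (32 * (1 + M) ^ 2) * η := by field_simp; ring
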